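/- arXiv:1301.3039 — 4 statements merged into one kernel-verified Lean document; each statement's English description precedes it below -/
import Mathlib

section
/- Let α, β, γ ∈ ℂ with Re β > −1 and with β, β+1, β+2, β+3 not nonpositive integers, and let ρ > 0 be a real number. Then ∫_{0}^{ρ} t^{β}·E(α;β;i/t)·E(α+γ;β;−i/t) dt = ρ^{β+1}·E(α;β;i/ρ)·E(α+γ, β+1; β, β+2; −i/ρ) − i·ρ^{β+2}·β·f(α, β+2, γ, β+1; i/ρ) − ρ^{β+3}·f(α, β+3, γ+1, β+1; i/ρ), where for t > 0 and complex exponent w, t^w = exp(w·log t). -/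
open Complex

/-- MacRobert E-function with one upper and one lower parameter:
`E(a;b;z) = ∑ Γ(a+n)/(n!·Γ(b+n))·(−1/z)^n`. -/
noncomputable def macE1 (a b z : ℂ) : ℂ :=
  ∑' n : ℕ, (Complex.Gamma (a + n) / ((n.factorial : ℂ) * Complex.Gamma (b + n))) * (-1 / z) ^ n

/-- MacRobert E-function with two upper and two lower parameters. -/
noncomputable def macE2 (a₁ a₂ b₁ b₂ z : ℂ) : ℂ :=
  ∑' n : ℕ, (Complex.Gamma (a₁ + n) * Complex.Gamma (a₂ + n) /
    ((n.factorial : ℂ) * Complex.Gamma (b₁ + n) * Complex.Gamma (b₂ + n))) * (-1 / z) ^ n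

/-- `f(α,β,γ,δ;z) = ∑_{ν} z^{−ν}·Γ(α+γ+ν)/(ν!·Γ(β+ν)) · E(α+1, β+ν; δ, β+1+ν; z)`. -/
noncomputable def fW (α β γ δ z : ℂ) : ℂ :=
  ∑' ν : ℕ, (z ^ (-(ν : ℤ)) * Complex.Gamma (α + γ + ν) /
    ((ν.factorial : ℂ) * Complex.Gamma (β + ν))) *
      macE2 (α + 1) (β + (ν : ℂ)) δ (β + 1 + (ν : ℂ)) z

/-- Pochhammer symbol `(a)_k = Γ(a+k)/Γ(a)`. -/
noncomputable def poch (a : ℂ) (k : ℕ) : ℂ := Complex.Gamma (a + k) / Complex.Gamma a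

/-- The `n`-th term `Γ(a+n)/(n!·Γ(b+n))·xⁿ` of the E-function series. -/
noncomputable def macTerm (a b x : ℂ) (n : ℕ) : ℂ :=
  Complex.Gamma (a + n) / ((n.factorial : ℂ) * Complex.Gamma (b + n)) * x ^ n

lemma succ_mul_macTerm_succ (a b x : ℂ) (n : ℕ) :
    ((n : ℂ) + 1) * macTerm a b x (n + 1) = x * macTerm (a + 1) (b + 1) x n := by
  have h : ((n : ℂ) + 1) ≠ 0 := Nat.cast_add_one_ne_zero n
  have ha : a + ((n + 1 : ℕ) : ℂ) = a + 1 + n := by push_cast; ring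
  have hb : b + ((n + 1 : ℕ) : ℂ) = b + 1 + n := by push_cast; ring
  rw [macTerm, macTerm, ha, hb, Nat.factorial_succ, pow_succ, Nat.cast_mul, Nat.cast_succ,
    mul_assoc ((n : ℂ) + 1), div_mul_eq_div_div]
  field_simp

lemma macTerm_div {a b x : ℂ} {n : ℕ} (h0 : b + n ≠ 0) (h1 : b + 1 + n ≠ 0) :
    macTerm a b x n / (b + 1 + n) = (b + n) * macTerm a (b + 2) x n := by
  have hG : Complex.Gamma (b + 2 + n) = (b + 1 + n) * ((b + n) * Complex.Gamma (b + n)) := by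
    rw [← Complex.Gamma_add_one _ h0, show b + n + 1 = b + 1 + n by ring,
      ← Complex.Gamma_add_one _ h1]
    congr 1; ring
  rw [macTerm, macTerm, hG]
  by_cases h : Complex.Gamma (b + n) = 0
  · simp [h]
  · have := Nat.cast_ne_zero (R := ℂ).2 n.factorial_ne_zero
    field_simp

lemma macTerm_succ {a b x : ℂ} {n : ℕ} (ha : a + n ≠ 0) (hb : b + n ≠ 0) :
    macTerm a b x (n + 1) = (a + n) / (((n : ℂ) + 1) * (b + n)) * x * macTerm a b x n := by
  have h : ((n : ℂ) + 1) ≠ 0 := Nat.cast_add_one_ne_zero n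
  rw [macTerm, macTerm, Nat.cast_succ, ← add_assoc, ← add_assoc, Complex.Gamma_add_one _ ha,
    Complex.Gamma_add_one _ hb, Nat.factorial_succ, pow_succ, Nat.cast_mul, Nat.cast_succ]
  simp only [div_eq_mul_inv, mul_inv]
  ring

lemma summable_norm_succ_mul_macTerm (a b x : ℂ) :
    Summable fun n : ℕ => ‖((n : ℂ) + 1) * macTerm a b x n‖ := by
  refine Summable.norm (summable_of_ratio_norm_eventually_le (r := 1 / 2) (by norm_num) ?_)
  filter_upwards [Filter.eventually_ge_atTop ⌈2 * ‖b‖ + ‖a‖ + 1 + 16 * ‖x‖⌉₊] with n hn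
  have hn : 2 * ‖b‖ + ‖a‖ + 1 + 16 * ‖x‖ ≤ n := Nat.ceil_le.1 hn
  have ha0 := norm_nonneg a
  have hb0 := norm_nonneg b
  have hx0 := norm_nonneg x
  have hnn : ‖(n : ℂ)‖ = n := Complex.norm_natCast n
  have hbn : (n : ℝ) / 2 ≤ ‖b + n‖ := by
    have := norm_sub_norm_le (n : ℂ) (-b)
    rw [norm_neg, sub_neg_eq_add, add_comm (n : ℂ), hnn] at this
    linarith
  have han : ‖a + n‖ ≤ 2 * n := by
    have := norm_add_le a (n : ℂ)
    rw [hnn] at this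
    linarith
  have han' : 0 < ‖a + n‖ := by
    have := norm_sub_norm_le (n : ℂ) (-a)
    rw [norm_neg, sub_neg_eq_add, add_comm (n : ℂ), hnn] at this
    linarith
  have hbn' : 0 < ‖b + n‖ := by linarith
  have hn1 : ‖(n : ℂ) + 1‖ = n + 1 := by exact_mod_cast Complex.norm_natCast (n + 1)
  have hn2 : ‖((n + 1 : ℕ) : ℂ) + 1‖ = n + 2 := by
    rw [← Nat.cast_succ, Complex.norm_natCast]; push_cast; ring
  rw [macTerm_succ (norm_pos_iff.1 han') (norm_pos_iff.1 hbn')]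
  simp only [norm_mul, norm_div, hn1, hn2]
  rw [← mul_assoc, ← mul_assoc (1 / 2 : ℝ)]
  refine mul_le_mul_of_nonneg_right ?_ (norm_nonneg _)
  have hq : ‖a + n‖ ≤ 4 * ‖b + n‖ := by linarith
  have hN : (0 : ℝ) < n + 1 := by positivity
  rw [← mul_assoc, mul_div_assoc', div_mul_eq_mul_div, div_le_iff₀ (by positivity)]
  calc ((n : ℝ) + 2) * ‖a + n‖ * ‖x‖ ≤ (2 * (n + 1)) * (4 * ‖b + n‖) * ((n + 1) / 16) := by
        gcongr <;> linarith
    _ = 1 / 2 * (n + 1) * ((n + 1) * ‖b + n‖) := by ring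

lemma summable_norm_macTerm (a b x : ℂ) : Summable fun n : ℕ => ‖macTerm a b x n‖ := by
  refine (summable_norm_succ_mul_macTerm a b x).of_nonneg_of_le (fun _ => norm_nonneg _) fun n => ?_
  rw [norm_mul]
  refine le_mul_of_one_le_left (norm_nonneg _) ?_
  have : ‖(n : ℂ) + 1‖ = n + 1 := by exact_mod_cast Complex.norm_natCast (n + 1)
  rw [this]
  linarith [(n.cast_nonneg : (0 : ℝ) ≤ n)]

lemma summable_norm_natCast_mul_macTerm (a b x : ℂ) :
    Summable fun n : ℕ => ‖(n : ℂ) * macTerm a b x n‖ := by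
  refine (summable_norm_succ_mul_macTerm a b x).of_nonneg_of_le (fun _ => norm_nonneg _) fun n => ?_
  rw [norm_mul, norm_mul]
  refine mul_le_mul_of_nonneg_right ?_ (norm_nonneg _)
  have : ‖(n : ℂ) + 1‖ = n + 1 := by exact_mod_cast Complex.norm_natCast (n + 1)
  rw [this, Complex.norm_natCast]
  linarith

lemma add_natCast_ne_zero {c : ℂ} (hc : 0 < c.re) (n : ℕ) : c + n ≠ 0 := fun h => by
  have := congrArg Complex.re h
  simp only [add_re, natCast_re, zero_re] at this
  linarith [(n.cast_nonneg : (0 : ℝ) ≤ n)]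

lemma re_le_norm_add_natCast {c : ℂ} (n : ℕ) : c.re ≤ ‖c + n‖ := by
  have := Complex.re_le_norm (c + n)
  simp only [add_re, natCast_re] at this
  linarith [(n.cast_nonneg : (0 : ℝ) ≤ n)]

lemma summable_norm_div_add_natCast {f : ℕ → ℂ} (hf : Summable fun n => ‖f n‖) {c : ℂ}
    (hc : 0 < c.re) : Summable fun n : ℕ => ‖f n / (c + n)‖ := by
  refine (hf.div_const c.re).of_nonneg_of_le (fun _ => norm_nonneg _) fun n => ?_
  rw [norm_div]
  exact div_le_div_of_nonneg_left (norm_nonneg _) hc (re_le_norm_add_natCast n)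

lemma summable_mul_div_add_natCast {f g : ℕ → ℂ} (hf : Summable fun n => ‖f n‖)
    (hg : Summable fun n => ‖g n‖) {c : ℂ} (hc : 0 < c.re) :
    Summable fun p : ℕ × ℕ => f p.1 * g p.2 / (c + p.1 + p.2) := by
  refine Summable.of_norm (((hf.mul_norm hg).div_const c.re).of_nonneg_of_le
    (fun _ => norm_nonneg _) fun p => ?_)
  rw [norm_div]
  refine div_le_div_of_nonneg_left (norm_nonneg _) hc ?_
  simpa [add_assoc] using re_le_norm_add_natCast (c := c) (p.1 + p.2)

lemma Gamma_div_Gamma_add_one {w : ℂ} (hw : 0 < w.re) :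
    Complex.Gamma w / Complex.Gamma (w + 1) = 1 / w := by
  have h0 : w ≠ 0 := fun h => by simp [h] at hw
  have hG := Complex.Gamma_ne_zero_of_re_pos hw
  rw [Complex.Gamma_add_one _ h0]
  field_simp

lemma macE1_eq (a b z : ℂ) : macE1 a b z = ∑' n, macTerm a b (-1 / z) n := rfl

lemma macE2_eq (a b c z : ℂ) (hc : 0 < c.re) :
    macE2 a c b (c + 1) z = ∑' n : ℕ, macTerm a b (-1 / z) n / (c + n) := by
  refine tsum_congr fun n => ?_
  have hw : 0 < (c + n).re := by
    simp only [add_re, natCast_re]; linarith [(n.cast_nonneg : (0 : ℝ) ≤ n)]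
  have := Gamma_div_Gamma_add_one hw
  rw [show c + 1 + n = c + n + 1 by ring, mul_div_mul_comm, this, macTerm]
  ring

lemma fW_eq (α β γ δ z : ℂ) (hβ : 0 < β.re) :
    fW α β γ δ z = ∑' p : ℕ × ℕ,
      macTerm (α + γ) β (1 / z) p.1 * macTerm (α + 1) δ (-1 / z) p.2 / (β + p.1 + p.2) := by
  rw [(summable_mul_div_add_natCast (summable_norm_macTerm _ _ _)
    (summable_norm_macTerm _ _ _) hβ).tsum_prod]
  refine tsum_congr fun n => ?_
  have hw : 0 < (β + n).re := by
    simp only [add_re, natCast_re]; linarith [(n.cast_nonneg : (0 : ℝ) ≤ n)]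
  rw [show β + 1 + (n : ℂ) = β + n + 1 by ring, macE2_eq _ _ _ _ hw, ← tsum_mul_left]
  refine tsum_congr fun m => ?_
  simp only [macTerm, zpow_neg, zpow_natCast, one_div, inv_pow]
  ring

lemma integral_mul_macE1_mul_macE1 (a a' b b' x y β : ℂ) (hβ : -1 < β.re) {ρ : ℝ} (hρ : 0 < ρ) :
    ∫ t in Set.Ioo (0 : ℝ) ρ, (t : ℂ) ^ β * (∑' n, macTerm a b (x * t) n) *
        (∑' n, macTerm a' b' (y * t) n) =
      (ρ : ℂ) ^ (β + 1) * ∑' p : ℕ × ℕ,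
        macTerm a' b' (y * ρ) p.1 * macTerm a b (x * ρ) p.2 / (β + 1 + p.1 + p.2) := by
  have hscale : ∀ (a b x : ℂ) (t : ℝ) (n : ℕ),
      macTerm a b (x * t) n = macTerm a b x n * (t : ℂ) ^ n := fun a b x t n => by
    rw [macTerm, macTerm, mul_pow, mul_assoc]
  set F : ℕ × ℕ → ℝ → ℂ := fun p t =>
    (macTerm a' b' y p.1 * macTerm a b x p.2) * (t : ℂ) ^ (β + ((p.1 + p.2 : ℕ) : ℂ)) with hF
  have hre : ∀ k : ℕ, -1 < (β + (k : ℂ)).re := fun k => by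
    simp only [add_re, natCast_re]; linarith [(k.cast_nonneg : (0 : ℝ) ≤ k)]
  have hFeq : ∀ p, ∀ t ∈ Set.Ioo (0 : ℝ) ρ, F p t =
      (t : ℂ) ^ β * (macTerm a' b' (y * t) p.1 * macTerm a b (x * t) p.2) := by
    intro p t ht
    have ht0 : (t : ℂ) ≠ 0 := by exact_mod_cast ht.1.ne'
    simp only [hF]
    rw [Complex.cpow_add _ _ ht0, Complex.cpow_natCast, hscale, hscale, pow_add]
    ring
  have hint : ∀ p, MeasureTheory.IntegrableOn (F p) (Set.Ioo 0 ρ) := fun p => by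
    have := intervalIntegral.intervalIntegrable_cpow' (a := 0) (b := ρ) (hre (p.1 + p.2))
    rw [intervalIntegrable_iff_integrableOn_Ioo_of_le hρ.le] at this
    exact this.const_mul _
  have hrpow : MeasureTheory.IntegrableOn (fun t : ℝ => t ^ β.re) (Set.Ioo 0 ρ) := by
    rw [← intervalIntegrable_iff_integrableOn_Ioo_of_le hρ.le]
    exact intervalIntegral.intervalIntegrable_rpow' hβ
  have hval : ∀ p, ∫ t in Set.Ioo (0 : ℝ) ρ, F p t = (ρ : ℂ) ^ (β + 1) *
      (macTerm a' b' (y * ρ) p.1 * macTerm a b (x * ρ) p.2 / (β + 1 + p.1 + p.2)) := by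
    intro p
    have hρ0 : (ρ : ℂ) ≠ 0 := by exact_mod_cast hρ.ne'
    have hne : β + ((p.1 + p.2 : ℕ) : ℂ) + 1 ≠ 0 := fun h => by
      have h1 := congrArg Complex.re h
      have h2 := hre (p.1 + p.2)
      rw [add_re, one_re, zero_re] at h1
      linarith
    simp only [hF]
    rw [MeasureTheory.integral_const_mul, ← MeasureTheory.integral_Ioc_eq_integral_Ioo,
      ← intervalIntegral.integral_of_le hρ.le, integral_cpow (Or.inl (hre _)), ofReal_zero,
      Complex.zero_cpow hne, sub_zero, hscale, hscale,
      show β + ((p.1 + p.2 : ℕ) : ℂ) + 1 = β + 1 + ((p.1 + p.2 : ℕ) : ℂ) by ring,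
      Complex.cpow_add _ _ hρ0, Complex.cpow_natCast, pow_add, Nat.cast_add, ← add_assoc]
    ring
  have hbound : ∀ p, ∫ t in Set.Ioo (0 : ℝ) ρ, ‖F p t‖ ≤
      ‖macTerm a' b' (y * ρ) p.1 * macTerm a b (x * ρ) p.2‖ *
        ∫ t in Set.Ioo (0 : ℝ) ρ, t ^ β.re := by
    intro p
    rw [← MeasureTheory.integral_const_mul]
    refine MeasureTheory.setIntegral_mono_on (hint p).norm (hrpow.const_mul _) measurableSet_Ioo
      fun t ht => ?_
    have hnt : ‖(t : ℂ)‖ = t := by rw [Complex.norm_real, Real.norm_of_nonneg ht.1.le]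
    have hnρ : ‖(ρ : ℂ)‖ = ρ := by rw [Complex.norm_real, Real.norm_of_nonneg hρ.le]
    have := Real.rpow_nonneg ht.1.le β.re
    have h1 := pow_le_pow_left₀ ht.1.le ht.2.le p.1
    have h2 := pow_le_pow_left₀ ht.1.le ht.2.le p.2
    have := ht.1.le
    rw [hFeq p t ht, norm_mul, Complex.norm_cpow_eq_rpow_re_of_pos ht.1, mul_comm]
    simp only [hscale, norm_mul, norm_pow, hnt, hnρ]
    gcongr
  have hsum := MeasureTheory.hasSum_integral_of_summable_integral_norm hint
    ((((summable_norm_macTerm a' b' (y * ρ)).mul_norm (summable_norm_macTerm a b (x * ρ))).mul_right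
      (∫ t in Set.Ioo (0 : ℝ) ρ, t ^ β.re)).of_nonneg_of_le
        (fun p => MeasureTheory.integral_nonneg fun t => norm_nonneg _) hbound)
  rw [← tsum_mul_left, ← tsum_congr hval, hsum.tsum_eq]
  refine MeasureTheory.setIntegral_congr_fun measurableSet_Ioo fun t ht => ?_
  rw [tsum_congr fun p => hFeq p t ht, tsum_mul_left,
    ← tsum_mul_tsum_of_summable_norm (summable_norm_macTerm _ _ _) (summable_norm_macTerm _ _ _)]
  ring

lemma tsum_natCast_mul_macTerm_left {a b x c : ℂ} (g : ℕ → ℂ) :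
    ∑' p : ℕ × ℕ, ((p.1 : ℂ) * macTerm a b x p.1) * g p.2 / (c + p.1 + p.2) =
      x * ∑' p : ℕ × ℕ, macTerm (a + 1) (b + 1) x p.1 * g p.2 / (c + 1 + p.1 + p.2) := by
  have hinj : Function.Injective (Prod.map Nat.succ id : ℕ × ℕ → ℕ × ℕ) :=
    Nat.succ_injective.prodMap Function.injective_id
  rw [← hinj.tsum_eq, ← tsum_mul_left]
  · refine tsum_congr fun p => ?_
    have := succ_mul_macTerm_succ a b x p.1
    simp only [Prod.map_fst, Prod.map_snd, id, Nat.succ_eq_add_one, Nat.cast_add, Nat.cast_one]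
    rw [this, show c + ((p.1 : ℂ) + 1) + p.2 = c + 1 + p.1 + p.2 by ring]
    ring
  · rintro ⟨n, m⟩ h
    cases n with
    | zero => simp at h
    | succ k => exact ⟨(k, m), rfl⟩

lemma tsum_natCast_mul_macTerm_right {a b x c : ℂ} (f : ℕ → ℂ) :
    ∑' p : ℕ × ℕ, f p.1 * ((p.2 : ℂ) * macTerm a b x p.2) / (c + p.1 + p.2) =
      x * ∑' p : ℕ × ℕ, f p.1 * macTerm (a + 1) (b + 1) x p.2 / (c + 1 + p.1 + p.2) := by
  rw [← (Equiv.prodComm ℕ ℕ).tsum_eq, ← (Equiv.prodComm ℕ ℕ).tsum_eq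
    (fun p : ℕ × ℕ => f p.1 * macTerm (a + 1) (b + 1) x p.2 / (c + 1 + p.1 + p.2))]
  have := tsum_natCast_mul_macTerm_left (a := a) (b := b) (x := x) (c := c) f
  simp only [Equiv.prodComm_apply, Prod.fst_swap, Prod.snd_swap]
  convert this using 3 with p
  · ring
  · ext p; ring

theorem stmt12 (α β γ : ℂ) (hre : -1 < β.re)
    (hβ : ∀ n : ℕ, β ≠ -(n : ℂ)) (hβ1 : ∀ n : ℕ, β + 1 ≠ -(n : ℂ))
    (hβ2 : ∀ n : ℕ, β + 2 ≠ -(n : ℂ)) (hβ3 : ∀ n : ℕ, β + 3 ≠ -(n : ℂ))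
    (ρ : ℝ) (hρ : 0 < ρ) :
    ∫ t in Set.Ioo (0 : ℝ) ρ,
        (t : ℂ) ^ β * macE1 α β (I / (t : ℂ)) * macE1 (α + γ) β (-I / (t : ℂ)) =
      (ρ : ℂ) ^ (β + 1) * macE1 α β (I / (ρ : ℂ)) *
          macE2 (α + γ) (β + 1) β (β + 2) (-I / (ρ : ℂ)) -
        I * (ρ : ℂ) ^ (β + 2) * β * fW α (β + 2) γ (β + 1) (I / (ρ : ℂ)) -
        (ρ : ℂ) ^ (β + 3) * fW α (β + 3) (γ + 1) (β + 1) (I / (ρ : ℂ)) := by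
  have h1 : 0 < (β + 1).re := by rw [add_re, one_re]; linarith
  have h2 : 0 < (β + 2).re := by rw [add_re, re_ofNat]; linarith
  have h3 : 0 < (β + 3).re := by rw [add_re, re_ofNat]; linarith
  have hρ0 : (ρ : ℂ) ≠ 0 := by exact_mod_cast hρ.ne'
  have hβn : ∀ n : ℕ, β + n ≠ 0 := fun n h => hβ n (eq_neg_of_add_eq_zero_left h)
  have hneg : ∀ t : ℂ, -1 / (I / t) = I * t := fun t => by
    rw [div_div_eq_mul_div, div_eq_mul_inv, Complex.inv_I]; ring
  have hpos : ∀ t : ℂ, -1 / (-I / t) = -I * t := fun t => by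
    rw [div_div_eq_mul_div, div_eq_mul_inv, ← Complex.inv_I, inv_inv, Complex.inv_I]; ring
  have hinv : 1 / (I / (ρ : ℂ)) = -I * ρ := by
    rw [one_div_div, div_eq_mul_inv, Complex.inv_I]; ring
  simp only [macE1_eq, hneg, hpos]
  rw [integral_mul_macE1_mul_macE1 _ _ _ _ _ _ _ hre hρ, show β + 2 = β + 1 + 1 by ring,
    macE2_eq _ _ _ _ h1, hpos, show β + 1 + 1 = β + 2 by ring, fW_eq _ _ _ _ _ h2,
    fW_eq _ _ _ _ _ h3, hneg, hinv]
  set p := macTerm α β (I * ρ) with hp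
  set q := macTerm (α + γ) β (-I * ρ) with hq
  set r := macTerm (α + γ) (β + 2) (-I * ρ) with hr
  have hps : Summable fun n => ‖p n‖ := summable_norm_macTerm _ _ _
  have hqs : Summable fun n => ‖q n‖ := summable_norm_macTerm _ _ _
  have hrs : Summable fun n => ‖r n‖ := summable_norm_macTerm _ _ _
  have hps' : Summable fun n : ℕ => ‖(n : ℂ) * p n‖ := summable_norm_natCast_mul_macTerm _ _ _
  have hrs' : Summable fun n : ℕ => ‖(n : ℂ) * r n‖ := summable_norm_natCast_mul_macTerm _ _ _
  have hqd := summable_norm_div_add_natCast hqs h1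
  have hA : ∑' n : ℕ × ℕ, r n.1 * ((n.2 : ℂ) * p n.2) / (β + 1 + n.1 + n.2) =
      I * ρ * ∑' n : ℕ × ℕ, r n.1 * macTerm (α + 1) (β + 1) (I * ρ) n.2 /
        (β + 2 + n.1 + n.2) := by
    rw [hp, tsum_natCast_mul_macTerm_right, show β + 1 + 1 = β + 2 by ring]
  have hB : ∑' n : ℕ × ℕ, ((n.1 : ℂ) * r n.1) * ((n.2 : ℂ) * p n.2) / (β + 1 + n.1 + n.2) =
      ρ ^ 2 * ∑' n : ℕ × ℕ, macTerm (α + (γ + 1)) (β + 3) (-I * ρ) n.1 *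
        macTerm (α + 1) (β + 1) (I * ρ) n.2 / (β + 3 + n.1 + n.2) := by
    rw [hr, tsum_natCast_mul_macTerm_left (fun m : ℕ => (m : ℂ) * p m), hp,
      tsum_natCast_mul_macTerm_right, ← mul_assoc, show β + 1 + 1 + 1 = β + 3 by ring,
      show β + 2 + 1 = β + 3 by ring, add_assoc α γ,
      show -I * (ρ : ℂ) * (I * ρ) = -(I * I) * ρ ^ 2 by ring, Complex.I_mul_I, neg_neg, one_mul]
  have hsplit : ∑' n : ℕ × ℕ, q n.1 * p n.2 / (β + 1 + n.1 + n.2) =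
      (∑' n, p n) * (∑' n : ℕ, q n / (β + 1 + n)) -
        (β * (∑' n : ℕ × ℕ, r n.1 * ((n.2 : ℂ) * p n.2) / (β + 1 + n.1 + n.2)) +
          ∑' n : ℕ × ℕ, ((n.1 : ℂ) * r n.1) * ((n.2 : ℂ) * p n.2) / (β + 1 + n.1 + n.2)) := by
    rw [mul_comm (∑' n, p n), tsum_mul_tsum_of_summable_norm hqd hps, ← tsum_mul_left,
      ← ((summable_mul_div_add_natCast hrs hps' h1).mul_left β).tsum_add
        (summable_mul_div_add_natCast hrs' hps' h1),
      ← (summable_mul_of_summable_norm hqd hps).tsum_sub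
        (((summable_mul_div_add_natCast hrs hps' h1).mul_left β).add
          (summable_mul_div_add_natCast hrs' hps' h1))]
    refine tsum_congr fun n => ?_
    have hn := add_natCast_ne_zero h1 n.1
    have hnm := add_natCast_ne_zero h1 (n.1 + n.2)
    rw [Nat.cast_add, ← add_assoc] at hnm
    have hqr : q n.1 / (β + 1 + n.1) = (β + n.1) * r n.1 := macTerm_div (hβn _) hn
    rw [hqr, (div_eq_iff hn).1 hqr]
    field_simp
    ring
  have hp2 : (ρ : ℂ) ^ (β + 2) = (ρ : ℂ) ^ (β + 1) * ρ := by
    rw [show β + 2 = β + 1 + 1 by ring, Complex.cpow_add (β + 1) 1 hρ0, Complex.cpow_one]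
  have hp3 : (ρ : ℂ) ^ (β + 3) = (ρ : ℂ) ^ (β + 1) * ρ ^ 2 := by
    rw [show β + 3 = β + 1 + (2 : ℕ) by push_cast; ring, Complex.cpow_add _ _ hρ0,
      Complex.cpow_natCast]
  rw [hsplit, hA, hB, hp2, hp3]
  ring
end

section
/- Let a, β, ζ ∈ ℂ, let l ∈ ℕ, let w ∈ ℂ with w ≠ 0, and assume β+n is not a nonpositive integer for n = 0,…,l+1 and that all series below converge. Then E(a, β+l+1−ζ; β, β+l+2−ζ; w) = ∑_{n=0}^{l+1} (−1/w)^n·(Γ(β+l+1)/Γ(β+n))·C(l+1, n)·E(a+n, β+l+n+1−ζ; β+l+n+1, β+l+n+2−ζ; w), where C(l+1, n) is the binomial coefficient. -/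
open Complex

/-- A Chu–Vandermonde summation in terms of reciprocal Gamma values. -/
theorem sum_choose_mul_descFactorial_div_Gamma (L : ℕ) :
    ∀ (N : ℕ) (β : ℂ), (∀ m : ℕ, β ≠ -(m : ℂ)) →
      ∑ n ∈ Finset.range (L + 1),
        (L.choose n : ℂ) * (N.descFactorial n : ℂ) / Complex.Gamma (β + n) =
      Complex.Gamma (β + L + N) / (Complex.Gamma (β + N) * Complex.Gamma (β + L)) := by
  have shift_ne (β : ℂ) (hβ : ∀ m : ℕ, β ≠ -(m : ℂ)) (k m : ℕ) : β + k ≠ -(m : ℂ) := by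
    intro h
    apply hβ (m + k)
    push_cast
    linear_combination h
  induction L with
  | zero =>
    intro N β hβ
    have hN := Complex.Gamma_ne_zero (shift_ne β hβ N)
    have h0 := Complex.Gamma_ne_zero hβ
    simp only [zero_add, Finset.sum_range_one, Nat.choose_self, Nat.descFactorial_zero,
      Nat.cast_one, Nat.cast_zero, add_zero]
    field_simp
  | succ L ih =>
    intro N β hβ
    have hN := Complex.Gamma_ne_zero (shift_ne β hβ N)
    have hL := Complex.Gamma_ne_zero (shift_ne β hβ L)
    have hL0 : β + L ≠ 0 := by simpa using shift_ne β hβ L 0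
    have hLN0 : β + L + N ≠ 0 := by
      have h := shift_ne β hβ (L + N) 0
      push_cast at h
      simpa [add_assoc] using h
    have pascal : ∑ n ∈ Finset.range (L + 1 + 1),
          ((L + 1).choose n : ℂ) * (N.descFactorial n : ℂ) / Complex.Gamma (β + n) =
        ∑ n ∈ Finset.range (L + 1),
          (L.choose n : ℂ) * (N.descFactorial n : ℂ) / Complex.Gamma (β + n) +
        ∑ n ∈ Finset.range (L + 1),
          (L.choose n : ℂ) * (N.descFactorial (n + 1) : ℂ) / Complex.Gamma (β + 1 + n) := by
      have extend : ∑ n ∈ Finset.range (L + 1),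
            (L.choose n : ℂ) * (N.descFactorial n : ℂ) / Complex.Gamma (β + n) =
          ∑ n ∈ Finset.range (L + 1 + 1),
            (L.choose n : ℂ) * (N.descFactorial n : ℂ) / Complex.Gamma (β + n) := by
        rw [Finset.sum_range_succ _ (L + 1)]
        simp
      rw [extend, Finset.sum_range_succ' _ (L + 1), Finset.sum_range_succ' _ (L + 1),
        add_right_comm, ← Finset.sum_add_distrib]
      congr 1
      · refine Finset.sum_congr rfl fun n _ => ?_
        have e : β + ((n + 1 : ℕ) : ℂ) = β + 1 + n := by push_cast; ring
        rw [e, Nat.choose_succ_succ]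
        push_cast
        ring
      · simp
    rw [pascal, ih N β hβ]
    have hΓ : Complex.Gamma (β + (L + 1 : ℕ) + N) =
        (β + L + N) * Complex.Gamma (β + L + N) := by
      rw [← Complex.Gamma_add_one _ hLN0]
      congr 1
      push_cast
      ring
    have hΓ' : Complex.Gamma (β + (L + 1 : ℕ)) = (β + L) * Complex.Gamma (β + L) := by
      rw [← Complex.Gamma_add_one _ hL0]
      congr 1
      push_cast
      ring
    rw [hΓ, hΓ']
    cases N with
    | zero =>
      simp only [Nat.zero_descFactorial_succ, Nat.cast_zero, mul_zero, zero_div,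
        Finset.sum_const_zero, add_zero] at hN ⊢
      field_simp
    | succ N =>
      have h1 : ∀ m : ℕ, β + 1 ≠ -(m : ℂ) := by simpa using shift_ne β hβ 1
      have step : ∑ n ∈ Finset.range (L + 1),
            (L.choose n : ℂ) * ((N + 1).descFactorial (n + 1) : ℂ) / Complex.Gamma (β + 1 + n) =
          (N + 1) * (Complex.Gamma (β + L + (N + 1 : ℕ)) /
            (Complex.Gamma (β + (N + 1 : ℕ)) * ((β + L) * Complex.Gamma (β + L)))) := by
        have e1 : β + L + (N + 1 : ℕ) = β + 1 + L + N := by push_cast; ring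
        have e2 : β + (N + 1 : ℕ) = β + 1 + N := by push_cast; ring
        have e3 : β + (L + 1 : ℕ) = β + 1 + L := by push_cast; ring
        rw [← hΓ', e1, e2, e3, ← ih N (β + 1) h1, Finset.mul_sum]
        refine Finset.sum_congr rfl fun n _ => ?_
        rw [Nat.succ_descFactorial_succ]
        push_cast
        ring
      rw [step]
      field_simp
      push_cast
      ring

theorem stmt15 (a β ζ w : ℂ) (l : ℕ) (hw : w ≠ 0)
    (hβ : ∀ n : ℕ, n ≤ l + 1 → ∀ m : ℕ, β + n ≠ -(m : ℂ))
    (hconvL : Summable fun m : ℕ =>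
      (Complex.Gamma (a + m) * Complex.Gamma (β + l + 1 - ζ + m) /
        ((m.factorial : ℂ) * Complex.Gamma (β + m) * Complex.Gamma (β + l + 2 - ζ + m))) *
          (-1 / w) ^ m)
    (hconvR : ∀ n : ℕ, n ≤ l + 1 → Summable fun m : ℕ =>
      (Complex.Gamma (a + n + m) * Complex.Gamma (β + l + n + 1 - ζ + m) /
        ((m.factorial : ℂ) * Complex.Gamma (β + l + n + 1 + m) *
          Complex.Gamma (β + l + n + 2 - ζ + m))) * (-1 / w) ^ m) :
    macE2 a (β + l + 1 - ζ) β (β + l + 2 - ζ) w =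
      ∑ n ∈ Finset.range (l + 2),
        (-1 / w) ^ n * (Complex.Gamma (β + l + 1) / Complex.Gamma (β + n)) *
          ((l + 1).choose n : ℂ) *
            macE2 (a + n) (β + l + n + 1 - ζ) (β + l + n + 1) (β + l + n + 2 - ζ) w := by
  have hβ0 : ∀ m : ℕ, β ≠ -(m : ℂ) := by simpa using hβ 0 (Nat.zero_le _)
  have shift_ne (k m : ℕ) : β + k ≠ -(m : ℂ) := by
    intro h
    apply hβ0 (m + k)
    push_cast
    linear_combination h
  let F : ℕ → ℕ → ℂ := fun n N =>
    (Complex.Gamma (β + l + 1) / Complex.Gamma (β + n)) * ((l + 1).choose n : ℂ) *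
      ((N.descFactorial n : ℂ) * (Complex.Gamma (a + N) * Complex.Gamma (β + l + 1 - ζ + N) /
        ((N.factorial : ℂ) * Complex.Gamma (β + l + 1 + N) *
          Complex.Gamma (β + l + 2 - ζ + N))) * (-1 / w) ^ N)
  have hF : ∀ n ∈ Finset.range (l + 2), HasSum (F n)
      ((-1 / w) ^ n * (Complex.Gamma (β + l + 1) / Complex.Gamma (β + n)) *
          ((l + 1).choose n : ℂ) *
            macE2 (a + n) (β + l + n + 1 - ζ) (β + l + n + 1) (β + l + n + 2 - ζ) w) := by
    intro n hn
    have hs := ((hconvR n (by have := Finset.mem_range.mp hn; omega)).hasSum).mul_left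
      ((-1 / w) ^ n * (Complex.Gamma (β + l + 1) / Complex.Gamma (β + n)) *
          ((l + 1).choose n : ℂ))
    have hz : ∑ i ∈ Finset.range n, F n i = 0 := by
      refine Finset.sum_eq_zero fun i hi => ?_
      simp [F, Nat.descFactorial_of_lt (Finset.mem_range.mp hi)]
    rw [← hasSum_nat_add_iff' n, hz, sub_zero]
    refine hs.congr_fun ?_
    intro m
    have hfac : (((m + n).factorial : ℕ) : ℂ) = m.factorial * (m + n).descFactorial n := by
      have := Nat.factorial_mul_descFactorial (Nat.le_add_left n m)
      rw [Nat.add_sub_cancel] at this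
      exact_mod_cast this.symm
    have hd : ((m + n).descFactorial n : ℂ) ≠ 0 := by
      have := Nat.factorial_ne_zero (m + n)
      intro h
      rw [h, mul_zero] at hfac
      exact this (by exact_mod_cast hfac)
    have e1 : a + ((m + n : ℕ) : ℂ) = a + n + m := by push_cast; ring
    have e2 : β + l + 1 - ζ + ((m + n : ℕ) : ℂ) = β + l + n + 1 - ζ + m := by push_cast; ring
    have e3 : β + l + 1 + ((m + n : ℕ) : ℂ) = β + l + n + 1 + m := by push_cast; ring
    have e4 : β + l + 2 - ζ + ((m + n : ℕ) : ℂ) = β + l + n + 2 - ζ + m := by push_cast; ring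
    have cancel (d f x y z : ℂ) (hd : d ≠ 0) : d * (x / (f * d * y * z)) = x / (f * y * z) := by
      rw [← mul_div_assoc, show f * d * y * z = d * (f * y * z) by ring,
        mul_div_mul_left _ _ hd]
    simp only [F]
    rw [hfac, e1, e2, e3, e4, cancel _ _ _ _ _ hd, pow_add]
    ring
  rw [← (hasSum_sum hF).tsum_eq, macE2]
  refine tsum_congr fun N => ?_
  have hV := sum_choose_mul_descFactorial_div_Gamma (l + 1) N β hβ0
  have hN := Complex.Gamma_ne_zero (shift_ne N)
  have hL := Complex.Gamma_ne_zero (shift_ne (l + 1))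
  have hLN := Complex.Gamma_ne_zero (shift_ne (l + 1 + N))
  push_cast at hV hL hLN
  simp only [← add_assoc] at hV hL hLN
  have hsum : ∑ n ∈ Finset.range (l + 2), F n N =
      Complex.Gamma (β + l + 1) * (∑ n ∈ Finset.range (l + 1 + 1),
        ((l + 1).choose n : ℂ) * (N.descFactorial n : ℂ) / Complex.Gamma (β + n)) *
      ((Complex.Gamma (a + N) * Complex.Gamma (β + l + 1 - ζ + N) /
        ((N.factorial : ℂ) * Complex.Gamma (β + l + 1 + N) *
          Complex.Gamma (β + l + 2 - ζ + N))) * (-1 / w) ^ N) := by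
    rw [Finset.mul_sum, Finset.sum_mul]
    refine Finset.sum_congr rfl fun n _ => ?_
    simp only [F]
    ring
  rw [hsum, hV]
  have hcoef : Complex.Gamma (β + l + 1) * (Complex.Gamma (β + l + 1 + N) /
      (Complex.Gamma (β + N) * Complex.Gamma (β + l + 1))) =
      Complex.Gamma (β + l + 1 + N) / Complex.Gamma (β + N) := by
    field_simp
  rw [hcoef, ← mul_assoc, div_mul_div_comm]
  congr 1
  rw [show Complex.Gamma (β + N) * ((N.factorial : ℂ) * Complex.Gamma (β + l + 1 + N) *
      Complex.Gamma (β + l + 2 - ζ + N)) = Complex.Gamma (β + l + 1 + N) *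
      ((N.factorial : ℂ) * Complex.Gamma (β + N) * Complex.Gamma (β + l + 2 - ζ + N)) by ring,
    mul_div_mul_left _ _ hLN]
end

section
/- Let α, β, γ ∈ ℂ, let l ∈ ℕ with Re β + l > −1, assume β+n is not a nonpositive integer for n = 0,…,l+1, and let ρ > 0 be a real number. Then ∫_{0}^{ρ} t^{β+l}·E(α;β;i/t)·E(α+γ;β;−i/t) dt = ρ^{β+l+1}·∑_{n=0}^{l+1} (−iρ)^n·(Γ(β+l+1)/Γ(β+n))·C(l+1, n)·f(α−1, β+l+n+1, γ+n+1, β; i/ρ), where C(l+1, n) is the binomial coefficient and for t > 0 and complex exponent w, t^w = exp(w·log t). -/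
open Complex

theorem gamma_nat_add_ne_zero {b : ℂ} (hb : ∀ m : ℕ, b ≠ -(m : ℂ)) (n : ℕ) :
    Complex.Gamma (b + n) ≠ 0 := by
  refine Complex.Gamma_ne_zero fun m h => hb (m + n) ?_
  push_cast
  linear_combination h

/-- The series `∑ Γ(a+n)/(n! Γ(b+n)) xⁿ` converges absolutely for every `x`. -/
theorem summable_norm_gamma_series (a : ℂ) {b : ℂ} (hb : ∀ m : ℕ, b ≠ -(m : ℂ)) (x : ℂ) :
    Summable fun n : ℕ =>
      ‖Complex.Gamma (a + n) / ((n.factorial : ℂ) * Complex.Gamma (b + n)) * x ^ n‖ := by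
  have hlin (c : ℂ) : Filter.Tendsto (fun n : ℕ => c / (n : ℂ)) Filter.atTop (nhds 0) :=
    tendsto_const_div_atTop_nhds_zero_nat c
  have hlim : Filter.Tendsto
      (fun n : ℕ => ‖(a / n + 1) / (b / n + 1) * (x / ((n + 1 : ℕ) : ℂ))‖)
      Filter.atTop (nhds 0) := by
    have h := ((((hlin a).add_const 1).div ((hlin b).add_const 1) (by simp)).mul
      ((Filter.tendsto_add_atTop_iff_nat 1).2 (hlin x))).norm
    simpa using h
  refine summable_of_ratio_norm_eventually_le (r := 1 / 2) (by norm_num) ?_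
  obtain ⟨N, hN⟩ := exists_nat_gt ‖a‖
  filter_upwards [hlim.eventually (ge_mem_nhds (by norm_num : (0 : ℝ) < 1 / 2)),
    Filter.eventually_ge_atTop N, Filter.eventually_gt_atTop 0] with n hn hNn hn0
  have hn0' : (n : ℂ) ≠ 0 := by exact_mod_cast hn0.ne'
  have han : a + n ≠ 0 := by
    intro h
    have : ‖a‖ = n := by rw [eq_neg_of_add_eq_zero_left h]; simp
    have : (N : ℝ) ≤ n := by exact_mod_cast hNn
    linarith
  have hbn : b + n ≠ 0 := fun h => hb n (eq_neg_of_add_eq_zero_left h)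
  have hG := gamma_nat_add_ne_zero hb n
  have hf : (n.factorial : ℂ) ≠ 0 := by exact_mod_cast n.factorial_ne_zero
  have hn1 : (n : ℂ) + 1 ≠ 0 := by exact_mod_cast n.succ_ne_zero
  rw [norm_norm, norm_norm]
  refine le_trans (le_of_eq ?_) (mul_le_mul_of_nonneg_right hn (norm_nonneg _))
  rw [← norm_mul]
  congr 1
  have e1 : a / n + 1 = (a + n) / n := by field_simp
  have e2 : b / n + 1 = (b + n) / n := by field_simp
  rw [e1, e2, Nat.factorial_succ]
  push_cast
  rw [← add_assoc, ← add_assoc, Complex.Gamma_add_one _ han, Complex.Gamma_add_one _ hbn, pow_succ]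
  field_simp

/-- The Chu–Vandermonde identity in terms of the Gamma function. -/
theorem sum_choose_mul_descFactorial_div_gamma (m : ℕ) :
    ∀ (j : ℕ) (b : ℂ), (∀ k : ℕ, b ≠ -(k : ℂ)) →
      ∑ n ∈ Finset.range (m + 1),
          (m.choose n : ℂ) * (j.descFactorial n : ℂ) / Complex.Gamma (b + n) =
        Complex.Gamma (b + m + j) / (Complex.Gamma (b + j) * Complex.Gamma (b + m)) := by
  induction m with
  | zero =>
    intro j b hb
    have := gamma_nat_add_ne_zero hb j
    simp
    field_simp
  | succ m ih =>
    intro j b hb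
    have hb1 : ∀ k : ℕ, b + 1 ≠ -(k : ℂ) := fun k h => hb (k + 1) (by
      push_cast; linear_combination h)
    have hG (k : ℕ) := gamma_nat_add_ne_zero hb k
    have hbm : b + m ≠ 0 := fun h => hb m (eq_neg_of_add_eq_zero_left h)
    have hbmj : b + m + j ≠ 0 := fun h => hb (m + j) (by push_cast; linear_combination h)
    have hsplit : ∑ n ∈ Finset.range (m + 1 + 1),
          ((m + 1).choose n : ℂ) * (j.descFactorial n : ℂ) / Complex.Gamma (b + n) =
        ∑ n ∈ Finset.range (m + 1),
          (m.choose n : ℂ) * (j.descFactorial n : ℂ) / Complex.Gamma (b + n) +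
        ∑ n ∈ Finset.range (m + 1),
          (m.choose n : ℂ) * (j.descFactorial (n + 1) : ℂ) / Complex.Gamma (b + 1 + n) := by
      have hext : ∑ n ∈ Finset.range (m + 1),
            (m.choose n : ℂ) * (j.descFactorial n : ℂ) / Complex.Gamma (b + n) =
          ∑ n ∈ Finset.range (m + 1 + 1),
            (m.choose n : ℂ) * (j.descFactorial n : ℂ) / Complex.Gamma (b + n) := by
        rw [Finset.sum_range_succ _ (m + 1)]
        simp
      rw [hext, Finset.sum_range_succ', Finset.sum_range_succ' _ (m + 1), add_right_comm,
        ← Finset.sum_add_distrib]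
      congr 1
      · refine Finset.sum_congr rfl fun n _ => ?_
        rw [Nat.choose_succ_succ]
        push_cast
        rw [show b + ((n : ℂ) + 1) = b + 1 + n by ring]
        ring
      · simp
    have hrec : ∑ n ∈ Finset.range (m + 1),
          (m.choose n : ℂ) * (j.descFactorial (n + 1) : ℂ) / Complex.Gamma (b + 1 + n) =
        j * Complex.Gamma (b + m + j) /
          (Complex.Gamma (b + j) * Complex.Gamma (b + m + 1)) := by
      cases j with
      | zero => simp
      | succ i =>
        have h := congrArg (fun z : ℂ => ((i + 1 : ℕ) : ℂ) * z) (ih i (b + 1) hb1)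
        simp only [Finset.mul_sum] at h
        rw [show b + ((i + 1 : ℕ) : ℂ) = b + 1 + i by push_cast; ring,
          show b + m + ((i + 1 : ℕ) : ℂ) = b + 1 + m + i by push_cast; ring,
          show b + m + 1 = b + 1 + m by ring, mul_div_assoc, ← h]
        refine Finset.sum_congr rfl fun n _ => ?_
        rw [Nat.succ_descFactorial_succ]
        push_cast
        ring
    rw [hsplit, hrec, ih j b hb]
    push_cast
    rw [show b + ((m : ℂ) + 1) + j = b + m + j + 1 by ring, ← add_assoc b,
      Complex.Gamma_add_one _ hbmj, Complex.Gamma_add_one _ hbm]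
    have h1 := hG j
    have h2 := hG m
    field_simp

/-- `(s + k)⁻¹` is bounded by `(Re s)⁻¹` when `Re s > 0`. -/
theorem norm_inv_add_nat_le {s : ℂ} (hs : 0 < s.re) (k : ℕ) : ‖(s + k)⁻¹‖ ≤ s.re⁻¹ := by
  rw [norm_inv]
  refine inv_anti₀ hs ?_
  have h := Complex.re_le_norm (s + k)
  simp only [Complex.add_re, Complex.natCast_re] at h
  have : (0 : ℝ) ≤ k := k.cast_nonneg
  linarith

theorem integrableOn_cpow_Ioo {w : ℂ} (hw : -1 < w.re) {ρ : ℝ} (hρ : 0 < ρ) :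
    MeasureTheory.IntegrableOn (fun t : ℝ => (t : ℂ) ^ w) (Set.Ioo 0 ρ) := by
  have h := intervalIntegral.intervalIntegrable_cpow' (a := 0) (b := ρ) hw
  rw [intervalIntegrable_iff_integrableOn_Ioo_of_le hρ.le] at h
  exact h

theorem integral_cpow_Ioo {w : ℂ} (hw : -1 < w.re) {ρ : ℝ} (hρ : 0 < ρ) :
    ∫ t in Set.Ioo (0 : ℝ) ρ, (t : ℂ) ^ w = (ρ : ℂ) ^ (w + 1) / (w + 1) := by
  have hw1 : w + 1 ≠ 0 := by
    intro h
    have := congrArg Complex.re h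
    simp at this
    linarith
  rw [← MeasureTheory.integral_Ioc_eq_integral_Ioo, ← intervalIntegral.integral_of_le hρ.le,
    integral_cpow (Or.inl hw)]
  simp [Complex.zero_cpow hw1]

/-- Termwise integration of a power times a product of two power series. -/
theorem integral_cpow_mul_tsum_mul_tsum {A B : ℕ → ℂ} {w : ℂ} (hw : -1 < w.re) {ρ : ℝ}
    (hρ : 0 < ρ) (u v : ℂ) (hA : Summable fun k => ‖A k * (u * ρ) ^ k‖)
    (hB : Summable fun j => ‖B j * (v * ρ) ^ j‖) :
    ∫ t in Set.Ioo (0 : ℝ) ρ,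
        (t : ℂ) ^ w * (∑' k, A k * (u * t) ^ k) * (∑' j, B j * (v * t) ^ j) =
      (ρ : ℂ) ^ (w + 1) *
        ∑' j, B j * (v * ρ) ^ j * ∑' k, A k * (u * ρ) ^ k * (w + 1 + j + k)⁻¹ := by
  have hρ0 : (ρ : ℂ) ≠ 0 := by exact_mod_cast hρ.ne'
  have hs : 0 < (w + 1).re := by simp; linarith
  let c : ℕ × ℕ → ℂ := fun p => B p.1 * v ^ p.1 * (A p.2 * u ^ p.2)
  let F : ℕ × ℕ → ℝ → ℂ := fun p t => c p * (t : ℂ) ^ (w + (p.1 + p.2 : ℕ))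
  have hwp (n : ℕ) : -1 < (w + (n : ℂ)).re := by
    have : (0 : ℝ) ≤ n := n.cast_nonneg
    simp
    linarith
  have hFint (p) : MeasureTheory.IntegrableOn (F p) (Set.Ioo 0 ρ) :=
    (integrableOn_cpow_Ioo (hwp _) hρ).const_mul _
  have hFeq (p : ℕ × ℕ) {t : ℝ} (ht : 0 < t) :
      F p t = (t : ℂ) ^ w * (B p.1 * (v * t) ^ p.1 * (A p.2 * (u * t) ^ p.2)) := by
    have ht0 : (t : ℂ) ≠ 0 := by exact_mod_cast ht.ne'
    simp only [F, c]
    rw [Complex.cpow_add _ _ ht0, Complex.cpow_natCast, pow_add, mul_pow, mul_pow]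
    ring
  have hprod : Summable fun p : ℕ × ℕ =>
      ‖B p.1 * (v * ρ) ^ p.1‖ * ‖A p.2 * (u * ρ) ^ p.2‖ :=
    hB.mul_of_nonneg hA (fun _ => norm_nonneg _) (fun _ => norm_nonneg _)
  have hFsum : Summable fun p => ∫ t in Set.Ioo (0 : ℝ) ρ, ‖F p t‖ := by
    refine (hprod.mul_right (∫ t in Set.Ioo (0 : ℝ) ρ, ‖(t : ℂ) ^ w‖)).of_nonneg_of_le
      (fun p => MeasureTheory.integral_nonneg fun t => norm_nonneg _) fun p => ?_
    rw [← MeasureTheory.integral_const_mul]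
    refine MeasureTheory.setIntegral_mono_on (hFint p).norm
      ((integrableOn_cpow_Ioo hw hρ).norm.const_mul _) measurableSet_Ioo fun t ht => ?_
    have htn : ‖(t : ℂ)‖ ≤ ‖(ρ : ℂ)‖ := by
      simpa [abs_of_pos ht.1, abs_of_pos hρ] using ht.2.le
    rw [hFeq p ht.1, norm_mul, norm_mul, mul_comm]
    simp only [norm_mul, norm_pow]
    gcongr
  have hFval (p : ℕ × ℕ) : ∫ t in Set.Ioo (0 : ℝ) ρ, F p t =
      (ρ : ℂ) ^ (w + 1) *
        (B p.1 * (v * ρ) ^ p.1 * (A p.2 * (u * ρ) ^ p.2 * (w + 1 + p.1 + p.2)⁻¹)) := by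
    simp only [F, c]
    rw [MeasureTheory.integral_const_mul, integral_cpow_Ioo (hwp _) hρ,
      show w + ((p.1 + p.2 : ℕ) : ℂ) + 1 = w + 1 + ((p.1 + p.2 : ℕ) : ℂ) by ring,
      Complex.cpow_add _ _ hρ0, Complex.cpow_natCast, pow_add, mul_pow, mul_pow]
    push_cast
    rw [← add_assoc]
    ring
  have hsum : Summable fun p : ℕ × ℕ =>
      B p.1 * (v * ρ) ^ p.1 * (A p.2 * (u * ρ) ^ p.2 * (w + 1 + p.1 + p.2)⁻¹) := by
    refine Summable.of_norm_bounded (hprod.mul_right (w + 1).re⁻¹) fun p => ?_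
    rw [norm_mul, norm_mul (A p.2 * _), ← mul_assoc]
    refine mul_le_mul_of_nonneg_left ?_ (by positivity)
    have := norm_inv_add_nat_le hs (p.1 + p.2)
    push_cast at this
    rwa [← add_assoc] at this
  calc ∫ t in Set.Ioo (0 : ℝ) ρ,
        (t : ℂ) ^ w * (∑' k, A k * (u * t) ^ k) * (∑' j, B j * (v * t) ^ j)
      = ∫ t in Set.Ioo (0 : ℝ) ρ, ∑' p, F p t := by
        refine MeasureTheory.setIntegral_congr_fun measurableSet_Ioo fun t ht => ?_
        have htn : ‖(t : ℂ)‖ ≤ ‖(ρ : ℂ)‖ := by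
          simpa [abs_of_pos ht.1, abs_of_pos hρ] using ht.2.le
        have hA' : Summable fun k => ‖A k * (u * t) ^ k‖ :=
          hA.of_nonneg_of_le (fun _ => norm_nonneg _) fun k => by
            simp only [norm_mul, norm_pow]
            gcongr
        have hB' : Summable fun j => ‖B j * (v * t) ^ j‖ :=
          hB.of_nonneg_of_le (fun _ => norm_nonneg _) fun k => by
            simp only [norm_mul, norm_pow]
            gcongr
        simp only [hFeq _ ht.1]
        rw [tsum_mul_left, ← tsum_mul_tsum_of_summable_norm hB' hA']
        ring
    _ = ∑' p, ∫ t in Set.Ioo (0 : ℝ) ρ, F p t :=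
        (MeasureTheory.integral_tsum_of_summable_integral_norm hFint hFsum).symm
    _ = _ := by
        simp only [hFval]
        rw [tsum_mul_left, hsum.tsum_prod]
        simp only [tsum_mul_left]

theorem stmt16 (α β γ : ℂ) (l : ℕ) (hre : -1 < β.re + l)
    (hβ : ∀ n : ℕ, n ≤ l + 1 → ∀ m : ℕ, β + n ≠ -(m : ℂ))
    (ρ : ℝ) (hρ : 0 < ρ) :
    ∫ t in Set.Ioo (0 : ℝ) ρ,
        (t : ℂ) ^ (β + l) * macE1 α β (I / (t : ℂ)) * macE1 (α + γ) β (-I / (t : ℂ)) =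
      (ρ : ℂ) ^ (β + l + 1) *
        ∑ n ∈ Finset.range (l + 2),
          (-I * (ρ : ℂ)) ^ n * (Complex.Gamma (β + l + 1) / Complex.Gamma (β + n)) *
            ((l + 1).choose n : ℂ) *
              fW (α - 1) (β + l + n + 1) (γ + n + 1) β (I / (ρ : ℂ)) := by
  have hb : ∀ m : ℕ, β ≠ -(m : ℂ) := fun m => by simpa using hβ 0 (Nat.zero_le _) m
  have hs : 0 < (β + l + 1).re := by simp; linarith
  have hb' (n : ℕ) : ∀ m : ℕ, β + l + 1 + n ≠ -(m : ℂ) := fun m h =>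
    hb (l + 1 + n + m) (by push_cast; linear_combination h)
  have hneg (t : ℂ) : -1 / (I / t) = I * t := by
    rw [div_div_eq_mul_div, div_I]
    ring
  have hpos (t : ℂ) : -1 / (-I / t) = -I * t := by
    rw [div_div_eq_mul_div, div_neg, div_I]
    ring
  let H : ℕ → ℂ := fun j => ∑' k : ℕ, Complex.Gamma (α + k) /
    ((k.factorial : ℂ) * Complex.Gamma (β + k)) * (I * ρ) ^ k * (β + l + 1 + j + k)⁻¹
  have hA := summable_norm_gamma_series α hb (I * ρ)
  obtain ⟨M, hM⟩ : ∃ M : ℝ, ∀ j, ‖H j‖ ≤ M := by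
    refine ⟨_, fun j => tsum_of_norm_bounded (hA.mul_right (β + l + 1).re⁻¹).hasSum fun k => ?_⟩
    rw [norm_mul]
    refine mul_le_mul_of_nonneg_left ?_ (norm_nonneg _)
    have := norm_inv_add_nat_le hs (j + k)
    push_cast at this
    rwa [← add_assoc] at this
  -- the summand of the `n`-th series on the right, extended by zero to all indices
  let S : ℕ → ℕ → ℂ := fun n j => (-I * ρ) ^ j * Complex.Gamma (α + γ + j) /
    ((j.factorial : ℂ) * Complex.Gamma (β + l + 1 + j)) * H j * j.descFactorial n
  have hshift (n ν : ℕ) : S n (ν + n) = (-I * ρ) ^ n *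
      (Complex.Gamma (α + γ + n + ν) /
        ((ν.factorial : ℂ) * Complex.Gamma (β + l + 1 + n + ν)) * (-I * ρ) ^ ν) *
          H (ν + n) := by
    have hf : (((ν + n).factorial : ℕ) : ℂ) = ν.factorial * (ν + n).descFactorial n := by
      rw [← Nat.factorial_mul_descFactorial (Nat.le_add_left n ν), Nat.add_sub_cancel]
      push_cast
      rfl
    have hd : ((ν + n).descFactorial n : ℂ) ≠ 0 := by
      exact_mod_cast (Nat.descFactorial_pos.2 (Nat.le_add_left n ν)).ne'
    have hν : (ν.factorial : ℂ) ≠ 0 := by exact_mod_cast ν.factorial_ne_zero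
    have hG := gamma_nat_add_ne_zero (hb' n) ν
    simp only [S]
    rw [hf]
    push_cast
    rw [show α + γ + ((ν : ℂ) + n) = α + γ + n + ν by ring,
      show β + l + 1 + ((ν : ℂ) + n) = β + l + 1 + n + ν by ring, pow_add]
    field_simp
  have hS (n : ℕ) : Summable (S n) := by
    refine (summable_nat_add_iff n).1 ?_
    refine Summable.of_norm_bounded
      (((summable_norm_gamma_series (α + γ + n) (hb' n) (-I * ρ)).mul_left
        ‖(-I * (ρ : ℂ)) ^ n‖).mul_right M) fun ν => ?_
    rw [hshift, norm_mul, norm_mul]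
    exact mul_le_mul_of_nonneg_left (hM _) (by positivity)
  have hf (n : ℕ) : (-I * (ρ : ℂ)) ^ n *
      fW (α - 1) (β + l + n + 1) (γ + n + 1) β (I / (ρ : ℂ)) = ∑' j, S n j := by
    have hsupp : Function.support (S n) ⊆ Set.range fun ν : ℕ => ν + n := by
      intro j hj
      refine ⟨j - n, Nat.sub_add_cancel ?_⟩
      by_contra! h
      exact hj (by simp [S, Nat.descFactorial_of_lt h])
    rw [← (add_left_injective n).tsum_eq hsupp, fW, ← tsum_mul_left]
    refine tsum_congr fun ν => ?_
    rw [hshift, macE2, hneg]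
    have hz : (I / (ρ : ℂ)) ^ (-(ν : ℤ)) = (-I * ρ) ^ ν := by
      rw [zpow_neg, zpow_natCast, ← inv_pow, inv_div, div_I]
      congr 1
      ring
    rw [hz, show α - 1 + (γ + n + 1) + ν = α + γ + n + ν by ring,
      show β + l + n + 1 + (ν : ℂ) = β + l + 1 + n + ν by ring]
    have hE : ∑' k : ℕ, Complex.Gamma (α - 1 + 1 + k) *
          Complex.Gamma (β + l + 1 + n + ν + k) /
          ((k.factorial : ℂ) * Complex.Gamma (β + k) *
            Complex.Gamma (β + l + n + 1 + 1 + ν + k)) * (I * (ρ : ℂ)) ^ k = H (ν + n) := by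
      refine tsum_congr fun k => ?_
      have hG := gamma_nat_add_ne_zero (hb' n) (ν + k)
      have hne : β + l + 1 + n + ν + k ≠ 0 := fun h =>
        hb' n (ν + k) (by push_cast; linear_combination h)
      push_cast at hG
      rw [← add_assoc] at hG
      push_cast
      rw [sub_add_cancel, show β + l + n + 1 + 1 + ν + k = β + l + 1 + n + ν + k + 1 by ring,
        Complex.Gamma_add_one _ hne,
        show β + l + 1 + ((ν : ℂ) + n) + k = β + l + 1 + n + ν + k by ring]
      have := gamma_nat_add_ne_zero hb k
      have : (k.factorial : ℂ) ≠ 0 := by exact_mod_cast k.factorial_ne_zero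
      field_simp
    rw [hE]
    ring
  have hre' : -1 < (β + l).re := by simpa using hre
  simp only [macE1, hneg, hpos]
  rw [integral_cpow_mul_tsum_mul_tsum hre' hρ I (-I) hA
    (summable_norm_gamma_series (α + γ) hb (-I * ρ))]
  congr 1
  calc _ = ∑' j, ∑ n ∈ Finset.range (l + 2),
        Complex.Gamma (β + l + 1) / Complex.Gamma (β + n) * ((l + 1).choose n : ℂ) * S n j := by
        refine tsum_congr fun j => ?_
        change _ * H j = _
        have hV := sum_choose_mul_descFactorial_div_gamma (l + 1) j β hb
        have hfac : ∑ n ∈ Finset.range (l + 2), Complex.Gamma (β + l + 1) /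
              Complex.Gamma (β + n) * ((l + 1).choose n : ℂ) * S n j =
            Complex.Gamma (β + l + 1) * ((-I * ρ) ^ j * Complex.Gamma (α + γ + j) /
              ((j.factorial : ℂ) * Complex.Gamma (β + l + 1 + j)) * H j) *
            ∑ n ∈ Finset.range (l + 1 + 1), ((l + 1).choose n : ℂ) *
              (j.descFactorial n : ℂ) / Complex.Gamma (β + n) := by
          rw [Finset.mul_sum]
          refine Finset.sum_congr rfl fun n _ => ?_
          simp only [S]
          ring
        have h0 := gamma_nat_add_ne_zero (hb' 0) 0
        have hj := gamma_nat_add_ne_zero (hb' 0) j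
        have hβj := gamma_nat_add_ne_zero hb j
        have hjf : (j.factorial : ℂ) ≠ 0 := by exact_mod_cast j.factorial_ne_zero
        simp only [Nat.cast_zero, add_zero] at h0 hj
        rw [hfac, hV]
        push_cast
        rw [← add_assoc β]
        field_simp
    _ = ∑ n ∈ Finset.range (l + 2), Complex.Gamma (β + l + 1) / Complex.Gamma (β + n) *
          ((l + 1).choose n : ℂ) * ∑' j, S n j := by
        rw [Summable.tsum_finsetSum fun n _ => (hS n).mul_left _]
        simp only [tsum_mul_left]
    _ = _ := by
        refine Finset.sum_congr rfl fun n _ => ?_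
        rw [← hf]
        ring
end

section
/- Let α, β, γ, ζ ∈ ℂ and let ρ > 0 and h > 0 be real numbers, with β not a nonpositive integer, and assume the series below converges. Then ∑_{ν=0}^∞ (−i/h)^ν·(Γ(α+γ+ν)·Γ(β+1−ζ+ν, ρh)/(ν!·Γ(β+ν))) = h^{β+1−ζ}·∫_{ρ}^{∞} t^{β−ζ}·e^{−h·t}·E(α+γ; β; −i/t) dt, where Γ(a, x) = ∫_{x}^{∞} u^{a−1}·e^{−u} du denotes the upper incomplete Gamma function (for real x > 0 and complex a, with u^{a−1} = exp((a−1)·log u)), and for t > 0 and complex exponent w, t^w = exp(w·log t). -/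
open Complex

/-- Upper incomplete Gamma function `Γ(a, x) = ∫_x^∞ u^{a−1} e^{−u} du` for real `x`,
with `u^{a−1} = exp((a−1)·log u)`. -/
noncomputable def incGamma (a : ℂ) (x : ℝ) : ℂ :=
  ∫ u in Set.Ioi x, (u : ℂ) ^ (a - 1) * Complex.exp (-(u : ℂ))

open MeasureTheory Set Filter Topology

lemma norm_incGamma_integrand (s : ℂ) {u : ℝ} (hu : 0 < u) :
    ‖(u : ℂ) ^ (s - 1) * Complex.exp (-(u : ℂ))‖ = Real.exp (-u) * u ^ (s.re - 1) := by
  rw [norm_mul, norm_cpow_eq_rpow_re_of_pos hu, norm_exp, mul_comm]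
  simp

lemma integrableOn_incGamma_integrand (s : ℂ) {x : ℝ} (hx : 0 < x) :
    IntegrableOn (fun u : ℝ => (u : ℂ) ^ (s - 1) * Complex.exp (-(u : ℂ))) (Ioi x) := by
  have hcont : ContinuousOn (fun u : ℝ => (u : ℂ) ^ (s - 1) * Complex.exp (-(u : ℂ))) (Ioi x) := by
    refine ContinuousOn.mul (fun u hu => ?_) (by fun_prop)
    exact (Complex.continuousAt_ofReal_cpow_const u _
      (Or.inr (hx.trans hu).ne')).continuousWithinAt
  have hreal : IntegrableOn (fun u : ℝ => Real.exp (-u) * u ^ (s.re - 1)) (Ioi x) := by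
    refine integrable_of_isBigO_exp_neg (b := 1 / 2) (by norm_num) (fun u hu => ?_)
      (Real.Gamma_integrand_isLittleO _).isBigO
    exact ((by fun_prop : Continuous fun u : ℝ => Real.exp (-u)).continuousAt.mul
      (Real.continuousAt_rpow_const _ _ (Or.inl (hx.trans_le hu).ne'))).continuousWithinAt
  refine Integrable.mono' hreal (hcont.aestronglyMeasurable measurableSet_Ioi) ?_
  filter_upwards [ae_restrict_mem measurableSet_Ioi] with u hu
  exact (norm_incGamma_integrand s (hx.trans hu)).le

lemma Gamma_add_nat_add_one {s : ℂ} (hs : 0 < s.re) (n : ℕ) :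
    Complex.Gamma (s + n + 1) = Complex.Gamma s * ∏ j ∈ Finset.range (n + 1), (s + j) := by
  have hne (k : ℕ) : s + k ≠ 0 := fun h => by
    have := congrArg Complex.re h
    simp only [add_re, natCast_re, zero_re] at this
    have := k.cast_nonneg (α := ℝ)
    linarith
  induction n with
  | zero => simpa [mul_comm] using Complex.Gamma_add_one s (by simpa using hne 0)
  | succ n ih =>
    rw [Complex.Gamma_add_one _ (hne (n + 1)), Finset.prod_range_succ, ← mul_assoc, ← ih]
    push_cast
    rw [← add_assoc]
    ring

lemma tendsto_norm_Gamma_add_nat_div {s : ℂ} (hs : 0 < s.re) :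
    Tendsto (fun n : ℕ => ‖Complex.Gamma (s + n + 1)‖ / ((n : ℝ) ^ s.re * n.factorial))
      atTop (𝓝 1) := by
  have hG : Complex.Gamma s ≠ 0 := Complex.Gamma_ne_zero_of_re_pos hs
  have hlim := (tendsto_const_nhds (x := Complex.Gamma s)).div
    (Complex.GammaSeq_tendsto_Gamma s) hG |>.norm
  rw [div_self hG, norm_one] at hlim
  refine hlim.congr' ?_
  filter_upwards [eventually_gt_atTop 0] with n hn
  have hn' : (0 : ℝ) < n := Nat.cast_pos.2 hn
  have hnorm : ‖(n : ℂ) ^ s‖ = (n : ℝ) ^ s.re := by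
    simpa using norm_cpow_eq_rpow_re_of_pos hn' s
  simp only [Pi.div_apply, Complex.GammaSeq]
  rw [Gamma_add_nat_add_one hs, div_div_eq_mul_div, norm_div, norm_mul ((n : ℂ) ^ s), hnorm,
    Complex.norm_natCast]

/-- The mass of the incomplete Gamma integrand is asymptotically comparable with `incGamma`. -/
lemma eventually_integral_norm_le_norm_incGamma_of_re_pos {s : ℂ} (hs : 0 < s.re) {x : ℝ}
    (hx : 0 < x) :
    ∀ᶠ n : ℕ in atTop,
      ∫ u in Ioi x, ‖(u : ℂ) ^ (s + n + 1 - 1) * Complex.exp (-(u : ℂ))‖ ≤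
        3 * ‖incGamma (s + n + 1) x‖ := by
  have hlower : Tendsto (fun n : ℕ => x ^ (s.re + 1) * (x ^ n / n.factorial)) atTop (𝓝 0) := by
    simpa using (FloorSemiring.tendsto_pow_div_factorial_atTop x).const_mul (x ^ (s.re + 1))
  have hreal : (0 : ℝ) < ((s.re : ℂ)).re := hs
  filter_upwards [(tendsto_norm_Gamma_add_nat_div hs).eventually_const_lt
      (by norm_num : (3 / 4 : ℝ) < 1),
    (tendsto_norm_Gamma_add_nat_div hreal).eventually_lt_const (by norm_num : (1 : ℝ) < 3 / 2),
    hlower.eventually_lt_const (by norm_num : (0 : ℝ) < 1 / 4),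
    eventually_gt_atTop 0] with n h1 h2 h3 hn
  rw [ofReal_re] at h2
  have hn1 : (1 : ℝ) ≤ n := Nat.one_le_cast.2 hn
  have hfac : (0 : ℝ) < n.factorial := by positivity
  set M : ℝ := (n : ℝ) ^ s.re * n.factorial with hM
  have hMfac : (n.factorial : ℝ) ≤ M :=
    le_mul_of_one_le_left hfac.le (Real.one_le_rpow hn1 hs.le)
  have hMpos : 0 < M := hfac.trans_le hMfac
  rw [lt_div_iff₀ hMpos] at h1
  rw [div_lt_iff₀ hMpos] at h2
  set w : ℂ := s + n + 1 with hw
  have hwre : w.re = s.re + n + 1 := by simp [hw]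
  have hwpos : 0 < w.re := by rw [hwre]; positivity
  set f : ℝ → ℂ := fun u => (u : ℂ) ^ (w - 1) * Complex.exp (-(u : ℂ)) with hf
  have hint : IntegrableOn f (Ioi 0) := by
    refine (Complex.GammaIntegral_convergent hwpos).congr_fun (fun u _ => ?_) measurableSet_Ioi
    simp [hf, mul_comm]
  have hGamma : Complex.Gamma w = ∫ u in Ioi 0, f u := by
    rw [Complex.Gamma_eq_integral hwpos, Complex.GammaIntegral]
    refine setIntegral_congr_fun measurableSet_Ioi fun u _ => ?_
    simp [hf, mul_comm]
  have hupper : ∫ u in Ioi x, ‖f u‖ ≤ 3 / 2 * M := by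
    have hle : ∫ u in Ioi x, ‖f u‖ ≤ ∫ u in Ioi 0, ‖f u‖ :=
      setIntegral_mono_set hint.norm (Eventually.of_forall fun _ => norm_nonneg _)
        (Ioi_subset_Ioi hx.le).eventuallyLE
    have heq : ∫ u in Ioi 0, ‖f u‖ = Real.Gamma w.re := by
      rw [Real.Gamma_eq_integral hwpos]
      exact setIntegral_congr_fun measurableSet_Ioi fun u hu => norm_incGamma_integrand w hu
    have hcast : ((s.re : ℂ) + n + 1) = ((w.re : ℝ) : ℂ) := by rw [hwre]; push_cast; rfl
    rw [hcast, Complex.Gamma_ofReal, Complex.norm_real] at h2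
    exact hle.trans (heq.trans_le ((Real.le_norm_self _).trans h2.le))
  have hsplit : Complex.Gamma w = (∫ u in Ioc 0 x, f u) + incGamma w x := by
    rw [hGamma, ← Ioc_union_Ioi_eq_Ioi hx.le, setIntegral_union Ioc_disjoint_Ioi_same
      measurableSet_Ioi (hint.mono_set Ioc_subset_Ioi_self)
      (hint.mono_set (Ioi_subset_Ioi hx.le))]
    rfl
  have hsmall : ‖∫ u in Ioc 0 x, f u‖ ≤ 1 / 4 * M := by
    have hbound : ∀ u ∈ Ioc 0 x, ‖f u‖ ≤ x ^ (s.re + n) := fun u hu => by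
      rw [hf, norm_incGamma_integrand w hu.1, hwre, add_sub_cancel_right]
      have he : Real.exp (-u) ≤ 1 := Real.exp_le_one_iff.2 (by linarith [hu.1])
      have hp : u ^ (s.re + n) ≤ x ^ (s.re + n) :=
        Real.rpow_le_rpow hu.1.le hu.2 (by positivity)
      exact (mul_le_of_le_one_left (Real.rpow_nonneg hu.1.le _) he).trans hp
    have hle := norm_setIntegral_le_of_norm_le_const (μ := volume) (by simp) hbound
    have hvol : (volume : Measure ℝ).real (Ioc 0 x) = x := by simp [Measure.real, hx.le]
    rw [hvol] at hle
    have hpow : x ^ (s.re + n) * x = x ^ (s.re + 1) * x ^ n := by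
      rw [Real.rpow_add hx, Real.rpow_add hx, Real.rpow_natCast, Real.rpow_one]
      ring
    rw [hpow] at hle
    rw [← mul_div_assoc, div_lt_iff₀ hfac] at h3
    linarith
  have htri := norm_add_le (∫ u in Ioc 0 x, f u) (incGamma w x)
  rw [← hsplit] at htri
  linarith

lemma eventually_integral_norm_le_norm_incGamma (s : ℂ) {x : ℝ} (hx : 0 < x) :
    ∀ᶠ n : ℕ in atTop,
      ∫ u in Ioi x, ‖(u : ℂ) ^ (s + n - 1) * Complex.exp (-(u : ℂ))‖ ≤
        3 * ‖incGamma (s + n) x‖ := by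
  obtain ⟨N, hN⟩ := exists_nat_gt (-s.re)
  have hpos : 0 < (s + N).re := by simp; linarith
  have hev := (tendsto_sub_atTop_nat (N + 1)).eventually
    (eventually_integral_norm_le_norm_incGamma_of_re_pos hpos hx)
  filter_upwards [hev, eventually_ge_atTop (N + 1)] with n hn hle
  have hcast : s + N + ((n - (N + 1) : ℕ) : ℂ) + 1 = s + n := by
    rw [Nat.cast_sub hle]
    push_cast
    ring
  rwa [hcast] at hn

lemma cpow_mul_exp_eq (s c : ℂ) {h t : ℝ} (hh : 0 < h) (ht : 0 < t) (n : ℕ) :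
    (t : ℂ) ^ (s - 1) * Complex.exp (-(h : ℂ) * t) * (c * (-I * t) ^ n) =
      (h : ℂ) ^ (1 - s) * ((-I / h) ^ n * c) *
        (((h * t : ℝ) : ℂ) ^ (s + n - 1) * Complex.exp (-((h * t : ℝ) : ℂ))) := by
  have hh' : (h : ℂ) ≠ 0 := ofReal_ne_zero.2 hh.ne'
  have ht' : (t : ℂ) ≠ 0 := ofReal_ne_zero.2 ht.ne'
  rw [ofReal_mul, mul_cpow_ofReal_nonneg hh.le ht.le, show s + n - 1 = (s - 1) + n by ring,
    cpow_add _ _ hh', cpow_add _ _ ht', cpow_natCast, cpow_natCast,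
    show (1 : ℂ) - s = -(s - 1) by ring, cpow_neg]
  have hs : (h : ℂ) ^ (s - 1) ≠ 0 := by simp [cpow_eq_zero_iff, hh']
  have hpow : (-I * t) ^ n = (-I / h) ^ n * (h ^ n * t ^ n) := by
    rw [← mul_pow, ← mul_pow]
    congr 1
    field_simp
  rw [neg_mul (h : ℂ), hpow]
  field_simp

theorem stmt19 (α β γ ζ : ℂ) (ρ h : ℝ) (hρ : 0 < ρ) (hh : 0 < h)
    (hβ : ∀ n : ℕ, β ≠ -(n : ℂ))
    (hconv : Summable fun ν : ℕ =>
      (-I / (h : ℂ)) ^ ν * (Complex.Gamma (α + γ + ν) * incGamma (β + 1 - ζ + ν) (ρ * h) /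
        ((ν.factorial : ℂ) * Complex.Gamma (β + ν)))) :
    ∑' ν : ℕ, (-I / (h : ℂ)) ^ ν *
        (Complex.Gamma (α + γ + ν) * incGamma (β + 1 - ζ + ν) (ρ * h) /
          ((ν.factorial : ℂ) * Complex.Gamma (β + ν))) =
      (h : ℂ) ^ (β + 1 - ζ) *
        ∫ t in Set.Ioi ρ,
          (t : ℂ) ^ (β - ζ) * Complex.exp (-(h : ℂ) * (t : ℂ)) *
            macE1 (α + γ) β (-I / (t : ℂ)) := by
  set s : ℂ := β + 1 - ζ with hs
  have hh' : (h : ℂ) ≠ 0 := ofReal_ne_zero.2 hh.ne'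
  have hhs : (h : ℂ) ^ s ≠ 0 := by simp [cpow_eq_zero_iff, hh']
  have hρh : 0 < h * ρ := mul_pos hh hρ
  rw [mul_comm ρ h] at hconv ⊢
  set c : ℕ → ℂ := fun n =>
    Complex.Gamma (α + γ + n) / ((n.factorial : ℂ) * Complex.Gamma (β + n)) with hc
  set g : ℕ → ℝ → ℂ := fun n u => (u : ℂ) ^ (s + n - 1) * Complex.exp (-(u : ℂ)) with hg
  set k : ℕ → ℂ := fun n => (h : ℂ) ^ (1 - s) * ((-I / h) ^ n * c n) with hk
  set F : ℕ → ℝ → ℂ := fun n t => k n * g n (h * t) with hF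
  have hterm (n : ℕ) : (-I / (h : ℂ)) ^ n *
      (Complex.Gamma (α + γ + n) * incGamma (s + n) (h * ρ) /
        ((n.factorial : ℂ) * Complex.Gamma (β + n))) =
      (-I / (h : ℂ)) ^ n * c n * incGamma (s + n) (h * ρ) := by
    simp only [hc]; ring
  simp only [hterm] at hconv ⊢
  have hF_int (n : ℕ) : IntegrableOn (F n) (Ioi ρ) :=
    ((integrableOn_Ioi_comp_mul_left_iff (g n) ρ hh).2
      (integrableOn_incGamma_integrand (s + n) hρh)).const_mul (k n)
  have hF_eval (n : ℕ) : ∫ t in Ioi ρ, F n t = k n * ((h : ℂ)⁻¹ * incGamma (s + n) (h * ρ)) := by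
    rw [integral_const_mul, integral_comp_mul_left_Ioi (g n) ρ hh, real_smul, ofReal_inv]
    rfl
  have hF_norm (n : ℕ) : ∫ t in Ioi ρ, ‖F n t‖ = ‖k n‖ * (h⁻¹ * ∫ u in Ioi (h * ρ), ‖g n u‖) := by
    simp only [hF, norm_mul (k n)]
    rw [integral_const_mul, integral_comp_mul_left_Ioi (fun u => ‖g n u‖) ρ hh, smul_eq_mul]
  have hF_sum : Summable fun n => ∫ t in Ioi ρ, ‖F n t‖ := by
    refine Summable.of_norm_bounded_eventually_nat
      (hconv.norm.mul_left (3 * (h⁻¹ * ‖(h : ℂ) ^ (1 - s)‖))) ?_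
    filter_upwards [eventually_integral_norm_le_norm_incGamma s hρh] with n hn
    rw [Real.norm_of_nonneg (integral_nonneg fun _ => norm_nonneg _), hF_norm]
    calc ‖k n‖ * (h⁻¹ * ∫ u in Ioi (h * ρ), ‖g n u‖)
        ≤ ‖k n‖ * (h⁻¹ * (3 * ‖incGamma (s + n) (h * ρ)‖)) := by gcongr
      _ = _ := by simp only [hk, norm_mul]; ring
  have hsum := hasSum_integral_of_summable_integral_norm hF_int hF_sum
  have hrhs : ∫ t in Ioi ρ, (t : ℂ) ^ (β - ζ) * Complex.exp (-(h : ℂ) * (t : ℂ)) *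
      macE1 (α + γ) β (-I / (t : ℂ)) = ∫ t in Ioi ρ, ∑' n, F n t := by
    refine setIntegral_congr_fun measurableSet_Ioi fun t ht => ?_
    have ht0 : 0 < t := hρ.trans ht
    have hz : (-1 : ℂ) / (-I / t) = -I * t := by
      rw [div_div_eq_mul_div, div_neg, div_I]
      ring
    simp only [macE1, hz]
    rw [← tsum_mul_left]
    refine tsum_congr fun n => ?_
    rw [show β - ζ = s - 1 by rw [hs]; ring]
    exact cpow_mul_exp_eq s (c n) hh ht0 n
  rw [hrhs, ← (hsum.mul_left ((h : ℂ) ^ s)).tsum_eq]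
  refine tsum_congr fun n => ?_
  rw [hF_eval]
  simp only [hk]
  rw [cpow_sub 1 s hh', cpow_one]
  field_simp
end
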